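/- Edge asymptotics at a corner (two-dimensional corner extension of Theorem 1): let φ ∈ (0, 2π), δ > 0, and let S := {r·e^{iθ} : 0 < r < δ, 0 < θ < φ} be an open sector. Let u : ℂ → ℝ be C² and harmonic on S with ∫_S (∂ₓu² + ∂_y u²) dA < ∞. Suppose there are continuous functions v₁, v₂ on (closure of S inside B(0, δ)) \ {0} agreeing with ∂ₓu, ∂_y u on S, such that the tangential derivative vanishes on the electrode edge: cos(0)·v₁(x) = v₁(x) = 0 for all x ∈ (0, δ) on the edge {θ = 0}, and the normal derivative vanishes on the other edge: −sin(φ)·v₁(r·e^{iφ}) + cos(φ)·v₂(r·e^{iφ}) = 0 for all r ∈ (0, δ). Then there exist A ∈ ℝ and C ≥ 0 such that for all x ∈ (0, δ/2): |v₂(x) − A·x^{π/(2φ) − 1}| ≤ C·x^{π/(2φ) − 1 + π/(2φ)}. In particular the normal current density on the electrode blows up like dist^{π/(2φ) − 1} at a corner of opening angle φ. -/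

import Mathlib

open MeasureTheory Complex Metric Real

open Set Filter Topology ComplexConjugate in
/-- A continuous function on a rectangle, holomorphic off the real axis, has vanishing boundary
integral. -/
lemma isConservativeOn_of_differentiableAt_off_real {f : ℂ → ℂ} {U : Set ℂ} (hc : ContinuousOn f U)
    (hd : ∀ z ∈ U, z.im ≠ 0 → DifferentiableAt ℂ f z) : IsConservativeOn f U := by
  have key : ∀ z w : ℂ, Rectangle z w ⊆ U → (0 : ℝ) ∉ Ioo (min z.im w.im) (max z.im w.im) →
      wedgeIntegral z w f + wedgeIntegral w z f = 0 := by
    intro z w hzw h0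
    rw [wedgeIntegral_add_wedgeIntegral_eq]
    refine integral_boundary_rect_eq_zero_of_continuousOn_of_differentiableOn f z w
      (hc.mono hzw) fun p hp => (hd p (hzw ?_) ?_).differentiableWithinAt
    · exact ⟨Ioo_subset_Icc_self hp.1, Ioo_subset_Icc_self hp.2⟩
    · rintro h
      exact h0 (h ▸ hp.2)
  intro z w hzw
  rw [← add_eq_zero_iff_eq_neg]
  by_cases h0 : (0 : ℝ) ∈ Ioo (min z.im w.im) (max z.im w.im)
  · have h0' : (0 : ℝ) ∈ uIcc z.im w.im := Ioo_subset_Icc_self h0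
    have hvert : ∀ a ∈ uIcc z.re w.re, ContinuousOn (fun y : ℝ => f (a + y * I)) (uIcc z.im w.im) := by
      intro a ha
      refine hc.comp (by fun_prop) fun y hy => hzw ⟨?_, ?_⟩ <;> simpa
    have hint : ∀ a ∈ uIcc z.re w.re, ∀ c ∈ uIcc z.im w.im, ∀ d ∈ uIcc z.im w.im,
        IntervalIntegrable (fun y : ℝ => f (a + y * I)) volume c d := fun a ha c hc' d hd' =>
      ((hvert a ha).mono (uIcc_subset_uIcc hc' hd')).intervalIntegrable
    have h1 := key z (w.re : ℂ) (fun p hp => hzw ⟨by simpa using hp.1,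
        uIcc_subset_uIcc_left h0' (by simpa using hp.2)⟩) (by
        simp only [ofReal_im, mem_Ioo, not_and]; intro h h'
        rcases le_total z.im 0 with h2 | h2 <;> simp_all)
    have h2 := key (z.re : ℂ) w (fun p hp => hzw ⟨by simpa using hp.1,
        uIcc_subset_uIcc_right h0' (by simpa using hp.2)⟩) (by
        simp only [ofReal_im, mem_Ioo, not_and]; intro h h'
        rcases le_total w.im 0 with h2 | h2 <;> simp_all)
    rw [wedgeIntegral_add_wedgeIntegral_eq] at h1 h2 ⊢
    rw [← intervalIntegral.integral_add_adjacent_intervals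
        (hint w.re right_mem_uIcc _ left_mem_uIcc _ h0') (hint _ right_mem_uIcc _ h0' _ right_mem_uIcc),
      ← intervalIntegral.integral_add_adjacent_intervals
        (hint z.re left_mem_uIcc _ left_mem_uIcc _ h0') (hint _ left_mem_uIcc _ h0' _ right_mem_uIcc)]
    simp only [ofReal_re, ofReal_im, smul_eq_mul] at h1 h2 ⊢
    linear_combination h1 + h2
  · exact key z w hzw h0

/-- A continuous function on an open set which is holomorphic off the real axis is holomorphic. -/
lemma differentiableOn_of_differentiableAt_off_real {f : ℂ → ℂ} {U : Set ℂ} (hU : IsOpen U)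
    (hc : ContinuousOn f U) (hd : ∀ z ∈ U, z.im ≠ 0 → DifferentiableAt ℂ f z) :
    DifferentiableOn ℂ f U := by
  intro z hz
  obtain ⟨r, hr, hrU⟩ := Metric.isOpen_iff.1 hU z hz
  have hcons := isConservativeOn_of_differentiableAt_off_real (hc.mono hrU)
    fun w hw => hd w (hrU hw)
  exact (((hcons.isExactOn_ball (hc.mono hrU)).differentiableOn isOpen_ball).differentiableAt
    (ball_mem_nhds z hr)).differentiableWithinAt

/-- Extension of a function on the closed upper half plane by reflection across the real axis. -/
noncomputable def schwarzReflect (Q : ℂ → ℂ) (w : ℂ) : ℂ :=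
  if 0 ≤ w.im then Q w else (starRingEnd ℂ) (Q ((starRingEnd ℂ) w))

open Set Filter Topology ComplexConjugate in
/-- **Schwarz reflection principle** on a punctured disc. -/
lemma differentiableOn_schwarzReflect {Q : ℂ → ℂ} {R : ℝ}
    (hc : ContinuousOn Q {w | 0 ≤ w.im ∧ w ≠ 0 ∧ ‖w‖ < R})
    (hd : ∀ w : ℂ, 0 < w.im → ‖w‖ < R → DifferentiableAt ℂ Q w)
    (hreal : ∀ x : ℝ, x ≠ 0 → |x| < R → (Q x).im = 0) :
    DifferentiableOn ℂ (schwarzReflect Q) (ball 0 R \ {0}) := by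
  have hopen : IsOpen (ball (0 : ℂ) R \ {0}) := isOpen_ball.sdiff isClosed_singleton
  refine differentiableOn_of_differentiableAt_off_real hopen ?_ ?_
  · refine ContinuousOn.if ?_ ?_ ?_
    · rintro w ⟨⟨hw, hw0⟩, hfr⟩
      have him : w.im = 0 := by
        have := frontier_le_subset_eq continuous_const continuous_im hfr
        exact this.symm
      have hwr : w = (w.re : ℂ) := Complex.ext rfl (by simpa using him)
      have h0 : w.re ≠ 0 := fun h => hw0 (by rw [mem_singleton_iff, hwr, h, ofReal_zero])
      have hR : |w.re| < R := by
        rw [mem_ball_zero_iff, hwr, norm_real] at hw; exact hw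
      rw [hwr, conj_ofReal, eq_comm, conj_eq_iff_im]
      exact hreal _ h0 hR
    · refine hc.mono ?_
      rintro w ⟨⟨hw, hw0⟩, hcl⟩
      rw [(isClosed_le continuous_const continuous_im).closure_eq] at hcl
      exact ⟨hcl, hw0, by simpa using hw⟩
    · refine continuous_conj.comp_continuousOn (hc.comp continuous_conj.continuousOn ?_)
      rintro w ⟨⟨hw, hw0⟩, hcl⟩
      have hcl' : w.im ≤ 0 := by
        have : closure {a : ℂ | ¬ 0 ≤ a.im} ⊆ {a : ℂ | a.im ≤ 0} :=
          closure_minimal (fun a ha => (not_le.1 ha).le) (isClosed_le continuous_im continuous_const)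
        exact this hcl
      refine ⟨by simpa using hcl', by simpa using hw0, by simpa using hw⟩
  · rintro w ⟨hw, hw0⟩ him
    rcases lt_or_gt_of_ne him with h | h
    · have hd' : DifferentiableAt ℂ (conj ∘ Q ∘ conj) w := by
        rw [differentiableAt_conj_conj_iff]
        exact hd _ (by simpa using h) (by simpa using hw)
      refine hd'.congr_of_eventuallyEq ?_
      filter_upwards [(isOpen_lt continuous_im continuous_const).mem_nhds h] with z hz
      simp [schwarzReflect, not_le.2 (show z.im < 0 from hz)]
    · refine (hd w h (by simpa using hw)).congr_of_eventuallyEq ?_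
      filter_upwards [(isOpen_lt continuous_const continuous_im).mem_nhds h] with z hz
      simp [schwarzReflect, (show 0 < z.im from hz).le]

open Set ENNReal in
/-- Sub-mean value inequality over circles, for holomorphic functions. -/
lemma enorm_mul_two_pi_le_lintegral_circle {P : ℂ → ℂ} {w : ℂ} {r : ℝ} (hr : 0 < r)
    (hd : DifferentiableOn ℂ P (closedBall w r)) :
    ENNReal.ofReal (2 * π) * ‖P w‖ₑ ≤ ∫⁻ θ in Ioo (-π) π, ‖P (circleMap w r θ)‖ₑ := by
  have havg : Real.circleAverage P w r = P w := by
    refine DiffContOnCl.circleAverage ?_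
    rw [abs_of_pos hr]
    exact DifferentiableOn.diffContOnCl (by rwa [closure_ball _ hr.ne'])
  rw [Real.circleAverage_def] at havg
  have hper : Function.Periodic (fun θ => P (circleMap w r θ)) (2 * π) :=
    fun θ => by simp [periodic_circleMap w r θ]
  have hshift := hper.intervalIntegral_add_eq (-π) 0
  rw [show -π + 2 * π = π by ring, zero_add] at hshift
  rw [← hshift, intervalIntegral.integral_of_le (by linarith [Real.pi_pos]),
    integral_Ioc_eq_integral_Ioo] at havg
  have h2 : (∫ θ in Ioo (-π) π, P (circleMap w r θ)) = (2 * π) • P w := by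
    rw [← havg, smul_smul, mul_inv_cancel₀ (by positivity), one_smul]
  calc ENNReal.ofReal (2 * π) * ‖P w‖ₑ = ‖∫ θ in Ioo (-π) π, P (circleMap w r θ)‖ₑ := by
        rw [h2, enorm_smul, Real.enorm_of_nonneg (by positivity)]
    _ ≤ _ := enorm_integral_le_lintegral_enorm _

open Set ENNReal in
/-- Sub-mean value inequality over discs, for holomorphic functions. -/
lemma ofReal_pi_mul_sq_mul_enorm_le_lintegral_ball {P : ℂ → ℂ} {w : ℂ} {r : ℝ} (hr : 0 < r)
    (hd : DifferentiableOn ℂ P (ball w r)) :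
    ENNReal.ofReal (π * r ^ 2) * ‖P w‖ₑ ≤ ∫⁻ z in ball w r, ‖P z‖ₑ := by
  classical
  set F : ℂ → ℝ≥0∞ := (ball w r).indicator fun z => ‖P z‖ₑ with hF
  have hFm : Measurable F := by
    rw [hF, ← piecewise_eq_indicator]
    exact hd.continuousOn.enorm.measurable_piecewise continuousOn_const measurableSet_ball
  rw [← lintegral_indicator measurableSet_ball, ← lintegral_add_left_eq_self _ w,
    ← Complex.lintegral_comp_polarCoord_symm, polarCoord_target, Measure.volume_eq_prod,
    ← Measure.prod_restrict]
  have hmeas : Measurable fun p : ℝ × ℝ =>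
      ENNReal.ofReal p.1 • F (w + Complex.polarCoord.symm p) := by
    simp only [Complex.polarCoord_symm_apply, smul_eq_mul]
    refine (by fun_prop : Measurable fun p : ℝ × ℝ => ENNReal.ofReal p.1).mul (hFm.comp ?_)
    fun_prop
  rw [lintegral_prod _ hmeas.aemeasurable]
  have hradial : ∫⁻ ρ in Ioo 0 r, ENNReal.ofReal ρ = ENNReal.ofReal (r ^ 2 / 2) := by
    rw [← ofReal_integral_eq_lintegral_ofReal]
    · rw [← integral_Ioc_eq_integral_Ioo, ← intervalIntegral.integral_of_le hr.le, integral_id]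
      simp
    · exact (continuous_id.integrableOn_Icc (a := 0) (b := r)).mono_set Ioo_subset_Icc_self
    · filter_upwards [ae_restrict_mem measurableSet_Ioo] with x hx using hx.1.le
  calc ENNReal.ofReal (π * r ^ 2) * ‖P w‖ₑ
      = ∫⁻ ρ in Ioo 0 r, ENNReal.ofReal ρ * (ENNReal.ofReal (2 * π) * ‖P w‖ₑ) := by
        rw [lintegral_mul_const _ (by fun_prop), hradial, ← mul_assoc,
          ← ENNReal.ofReal_mul (by positivity)]
        congr 2; ring
    _ ≤ ∫⁻ ρ in Ioo 0 r, ∫⁻ θ in Ioo (-π) π,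
          ENNReal.ofReal ρ • F (w + Complex.polarCoord.symm (ρ, θ)) := by
        refine setLIntegral_mono' measurableSet_Ioo fun ρ hρ => ?_
        simp only [smul_eq_mul]
        rw [lintegral_const_mul' _ _ ofReal_ne_top]
        gcongr
        refine (enorm_mul_two_pi_le_lintegral_circle hρ.1
          (hd.mono (closedBall_subset_ball hρ.2))).trans_eq ?_
        refine lintegral_congr fun θ => ?_
        have hmem : circleMap w ρ θ ∈ ball w r := by
          simp [circleMap, abs_of_pos hρ.1, hρ.2]
        have : w + Complex.polarCoord.symm (ρ, θ) = circleMap w ρ θ := by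
          simp [circleMap, Complex.exp_mul_I, Complex.polarCoord_symm_apply]
        rw [this, hF, indicator_of_mem hmem]
    _ ≤ _ := lintegral_mono_set Ioo_subset_Ioi_self

open Set ENNReal Filter Topology in
/-- A holomorphic function on a punctured disc which is integrable against `‖z‖⁻²` tends to zero
at the puncture. -/
lemma tendsto_zero_of_integrableOn_div_sq {P : ℂ → ℂ} {R : ℝ} (hR : 0 < R)
    (hd : DifferentiableOn ℂ P (ball 0 R \ {0}))
    (hint : IntegrableOn (fun z => P z / z ^ 2) (ball 0 R)) : Tendsto P (𝓝[≠] 0) (𝓝 0) := by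
  set E : ℝ → ℝ≥0∞ := fun ρ => ∫⁻ z in ball (0 : ℂ) ρ, ‖P z / z ^ 2‖ₑ ∂(volume.restrict (ball 0 R))
  have hE : Tendsto E (𝓝 0) (𝓝 0) := by
    refine tendsto_setLIntegral_zero hint.2.ne ?_
    have h1 : Tendsto (fun ρ : ℝ => ENNReal.ofReal ρ ^ 2 * NNReal.pi) (𝓝 0) (𝓝 0) := by
      have := ((ENNReal.continuous_pow 2).comp ENNReal.continuous_ofReal).tendsto 0
      have := ENNReal.Tendsto.mul_const this (b := (NNReal.pi : ℝ≥0∞)) (Or.inr coe_ne_top)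
      simpa using this
    refine tendsto_of_tendsto_of_tendsto_of_le_of_le tendsto_const_nhds h1 (fun _ => zero_le)
      fun ρ => ?_
    exact (Measure.restrict_apply_le _ _).trans_eq (Complex.volume_ball 0 ρ)
  have hbound : ∀ w : ℂ, w ≠ 0 → ‖w‖ < R / 2 → ‖P w‖ₑ ≤ ENNReal.ofReal (9 / π) * E (2 * ‖w‖) := by
    intro w hw hwR
    have hw' : 0 < ‖w‖ := norm_pos_iff.2 hw
    have hnorm : ∀ z ∈ ball w (‖w‖ / 2), ‖w‖ / 2 < ‖z‖ ∧ ‖z‖ < 3 / 2 * ‖w‖ := by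
      intro z hz
      rw [mem_ball, dist_eq_norm] at hz
      have h1 := norm_sub_norm_le w z
      have h2 := norm_sub_norm_le z w
      rw [norm_sub_rev] at h1
      constructor <;> linarith
    have hsub : ball w (‖w‖ / 2) ⊆ ball 0 R \ {0} := fun z hz => by
      have := hnorm z hz
      refine ⟨by rw [mem_ball_zero_iff]; linarith, fun h => ?_⟩
      rw [mem_singleton_iff.1 h, norm_zero] at this
      linarith
    have hmv := ofReal_pi_mul_sq_mul_enorm_le_lintegral_ball (half_pos hw') (hd.mono hsub)
    have hle : ∫⁻ z in ball w (‖w‖ / 2), ‖P z‖ₑ ≤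
        ENNReal.ofReal ((3 / 2 * ‖w‖) ^ 2) * E (2 * ‖w‖) := by
      rw [← lintegral_const_mul' _ _ ofReal_ne_top, Measure.restrict_restrict measurableSet_ball]
      refine le_trans (setLIntegral_mono' measurableSet_ball fun z hz => ?_)
        (lintegral_mono_set fun z hz => ?_) (b := ∫⁻ z in ball w (‖w‖ / 2),
          ENNReal.ofReal ((3 / 2 * ‖w‖) ^ 2) * ‖P z / z ^ 2‖ₑ)
      · have := hnorm z hz
        rw [← ofReal_norm, ← ofReal_norm, ← ENNReal.ofReal_mul (by positivity)]
        refine ENNReal.ofReal_le_ofReal ?_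
        rw [norm_div, norm_pow, mul_div_assoc', le_div_iff₀ (by nlinarith), mul_comm]
        gcongr
        exact this.2.le
      · have := hnorm z hz
        exact ⟨by rw [mem_ball_zero_iff]; linarith, (hsub hz).1⟩
    have hpos : 0 < π * (‖w‖ / 2) ^ 2 := by positivity
    have hkey := hmv.trans hle
    rw [show (3 / 2 * ‖w‖) ^ 2 = (π * (‖w‖ / 2) ^ 2) * (9 / π) by field_simp; ring,
      ENNReal.ofReal_mul hpos.le, mul_assoc] at hkey
    exact (ENNReal.mul_le_mul_iff_right (by simpa using hpos) ofReal_ne_top).1 hkey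
  rw [tendsto_zero_iff_enorm_tendsto_zero]
  have hlim : Tendsto (fun w : ℂ => ENNReal.ofReal (9 / π) * E (2 * ‖w‖)) (𝓝[≠] 0) (𝓝 0) := by
    have h1 : Tendsto (fun w : ℂ => 2 * ‖w‖) (𝓝[≠] 0) (𝓝 0) := by
      have : Continuous fun w : ℂ => 2 * ‖w‖ := by fun_prop
      simpa using (this.tendsto 0).mono_left nhdsWithin_le_nhds
    have := ENNReal.Tendsto.const_mul (hE.comp h1) (a := ENNReal.ofReal (9 / π))
      (Or.inr ofReal_ne_top)
    simpa using this
  refine tendsto_of_tendsto_of_tendsto_of_le_of_le' tendsto_const_nhds hlim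
    (Eventually.of_forall fun _ => zero_le) ?_
  filter_upwards [self_mem_nhdsWithin,
    mem_nhdsWithin_of_mem_nhds (ball_mem_nhds (0 : ℂ) (half_pos hR))] with w hw hwR
  exact hbound w hw (by simpa using hwR)

open Set Filter Topology in
/-- First order expansion of a holomorphic function at a removable zero. -/
lemma exists_norm_sub_mul_le_of_tendsto_zero {P : ℂ → ℂ} {R : ℝ} (hR : 0 < R)
    (hd : DifferentiableOn ℂ P (ball 0 R \ {0})) (hlim : Tendsto P (𝓝[≠] 0) (𝓝 0)) :
    ∃ c : ℂ, ∃ K > 0, ∃ ρ > 0, ∀ w : ℂ, w ≠ 0 → ‖w‖ < ρ → ‖P w - w * c‖ ≤ K * ‖w‖ ^ 2 := by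
  have hnhds : ball (0 : ℂ) R ∈ 𝓝 0 := ball_mem_nhds _ hR
  set G := Function.update P 0 0 with hG
  have hGP : ∀ w, w ≠ 0 → G w = P w := fun w hw => Function.update_of_ne hw _ _
  have hGd : DifferentiableOn ℂ G (ball 0 R) := by
    rw [← differentiableOn_compl_singleton_and_continuousAt_iff hnhds]
    refine ⟨hd.congr fun w hw => hGP w hw.2, ?_⟩
    rw [continuousAt_update_same]
    exact hlim
  have hq : DifferentiableAt ℂ (dslope G 0) 0 :=
    ((differentiableOn_dslope hnhds).2 hGd).differentiableAt hnhds
  obtain ⟨K, hK, hb⟩ := hq.isBigO_sub.exists_pos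
  rw [Asymptotics.isBigOWith_iff, Metric.eventually_nhds_iff_ball] at hb
  obtain ⟨ρ, hρ, hb⟩ := hb
  refine ⟨dslope G 0 0, K, hK, ρ, hρ, fun w hw hwρ => ?_⟩
  have h1 := hb w (by simpa using hwρ)
  have h2 : P w = w * dslope G 0 w := by
    have := sub_smul_dslope G 0 w
    rw [sub_zero, smul_eq_mul, hGP w hw] at this
    rw [this]; simp [hG]
  rw [h2, ← mul_sub, norm_mul]
  rw [sub_zero] at h1
  nlinarith [norm_nonneg w]

open Set Filter Topology in
/-- Square root of a two-term expansion: if `(x v(x))² = L x^{2β} + O(x^{4β})` then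
`v(x) = A x^{β-1} + O(x^{2β-1})`, on half of the interval of continuity. -/
lemma exists_expansion_of_sq_expansion {v : ℝ → ℝ} {δ β L K ρ : ℝ} (hδ : 0 < δ) (hβ : 0 < β)
    (hL : 0 ≤ L) (hK : 0 < K) (hρ : 0 < ρ) (hv : ContinuousOn v (Ioo 0 δ))
    (h : ∀ x : ℝ, 0 < x → x < ρ → |v x ^ 2 * x ^ 2 - x ^ (2 * β) * L| ≤ K * (x ^ (2 * β)) ^ 2) :
    ∃ A C : ℝ, 0 ≤ C ∧ ∀ x : ℝ, 0 < x → x < δ / 2 →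
      |v x - A * x ^ (β - 1)| ≤ C * x ^ (β - 1 + β) := by
  have habs : ∀ x, 0 < x → x < ρ → |(|v x| * x - √L * x ^ β)| ≤ √K * (x ^ β) ^ 2 := by
    intro x hx hxρ
    have hy : 0 < x ^ β := Real.rpow_pos_of_pos hx β
    have hx2 : x ^ (2 * β) = (x ^ β) ^ 2 := by
      rw [mul_comm, Real.rpow_mul hx.le, Real.rpow_two]
    have h1 := h x hx hxρ
    rw [hx2, show v x ^ 2 * x ^ 2 - (x ^ β) ^ 2 * L =
      (|v x| * x - √L * x ^ β) * (|v x| * x + √L * x ^ β) by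
        nlinarith [Real.sq_sqrt hL, sq_abs (v x)], abs_mul] at h1
    refine abs_le_of_sq_le_sq ?_ (by positivity)
    rw [← sq_abs]
    have h2 : |(|v x| * x - √L * x ^ β)| ≤ |(|v x| * x + √L * x ^ β)| := by
      have ha : 0 ≤ |v x| * x := by positivity
      have hb : 0 ≤ √L * x ^ β := by positivity
      rw [abs_of_nonneg (add_nonneg ha hb), abs_le]
      constructor <;> linarith
    calc |(|v x| * x - √L * x ^ β)| ^ 2
        ≤ |(|v x| * x - √L * x ^ β)| * |(|v x| * x + √L * x ^ β)| := by
          rw [sq]; gcongr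
      _ ≤ K * ((x ^ β) ^ 2) ^ 2 := h1
      _ = (√K * (x ^ β) ^ 2) ^ 2 := by rw [mul_pow (√K), Real.sq_sqrt hK.le]
  obtain ⟨A, x₁, hx₁, hx₁δ, hnear⟩ : ∃ A x₁ : ℝ, 0 < x₁ ∧ x₁ ≤ δ / 2 ∧ ∀ x, 0 < x → x < x₁ →
      |v x * x - A * x ^ β| ≤ √K * (x ^ β) ^ 2 := by
    rcases hL.eq_or_lt with rfl | hL'
    · refine ⟨0, min ρ (δ / 2), by positivity, min_le_right _ _, fun x hx hx' => ?_⟩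
      have := habs x hx (hx'.trans_le (min_le_left _ _))
      rw [Real.sqrt_zero, zero_mul, sub_zero, abs_mul, abs_abs] at this
      rwa [zero_mul, sub_zero, abs_mul]
    · have hsL : 0 < √L := Real.sqrt_pos.2 hL'
      have hlim : Tendsto (fun x : ℝ => √K * x ^ β) (𝓝 0) (𝓝 0) := by
        have := ((Real.continuous_rpow_const hβ.le).tendsto 0).const_mul √K
        simpa [Real.zero_rpow hβ.ne'] using this
      obtain ⟨x₂, hx₂, hsmall⟩ := Metric.eventually_nhds_iff_ball.1
        (hlim.eventually (gt_mem_nhds hsL))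
      have hne : ∀ x, 0 < x → x < ρ → x < x₂ → v x ≠ 0 := by
        intro x hx hxρ hxx₂ hv0
        have h1 := habs x hx hxρ
        have h2 := hsmall x (by rw [mem_ball_zero_iff, Real.norm_of_nonneg hx.le]; exact hxx₂)
        have hy : 0 < x ^ β := Real.rpow_pos_of_pos hx β
        rw [hv0, abs_zero, zero_mul, zero_sub, abs_neg, abs_of_pos (by positivity)] at h1
        nlinarith
      set x₁ := min (min ρ x₂) (δ / 2)
      have hx₁ : 0 < x₁ := by positivity
      have hlt : ∀ x, x < x₁ → x < ρ ∧ x < x₂ ∧ x < δ / 2 := fun x hx => by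
        simpa [x₁, and_assoc] using hx
      have hcont : ContinuousOn v (Ioo 0 x₁) := hv.mono fun x hx =>
        ⟨hx.1, by linarith [(hlt x hx.2).2.2]⟩
      rcases isPreconnected_Ioo.eq_or_eq_neg_of_sq_eq hcont hcont.abs
        (fun x _ => by simp [sq_abs]) (fun {x} hx => by
          simpa using hne x hx.1 (hlt x hx.2).1 (hlt x hx.2).2.1) with hsgn | hsgn
      · refine ⟨√L, x₁, hx₁, min_le_right _ _, fun x hx hx' => ?_⟩
        have := habs x hx (hlt x hx').1
        have hvx : v x = |v x| := hsgn ⟨hx, hx'⟩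
        rwa [← hvx] at this
      · refine ⟨-√L, x₁, hx₁, min_le_right _ _, fun x hx hx' => ?_⟩
        have := habs x hx (hlt x hx').1
        rw [← abs_neg]
        have hvx : v x = -|v x| := hsgn ⟨hx, hx'⟩
        rw [hvx]
        convert this using 2
        ring
  obtain ⟨C, hC⟩ := isCompact_Icc.exists_bound_of_continuousOn
    (s := Icc x₁ (δ / 2)) (f := fun x => (v x - A * x ^ (β - 1)) / x ^ (β - 1 + β)) <| by
      have hpos : ∀ x ∈ Icc x₁ (δ / 2), 0 < x := fun x hx => hx₁.trans_le hx.1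
      have hpow : ∀ p : ℝ, ContinuousOn (fun x : ℝ => x ^ p) (Icc x₁ (δ / 2)) := fun p x hx =>
        (Real.continuousAt_rpow_const x p (Or.inl (hpos x hx).ne')).continuousWithinAt
      refine ContinuousOn.div (ContinuousOn.sub (hv.mono fun x hx => ?_)
        (continuousOn_const.mul (hpow _))) (hpow _) fun x hx =>
          (Real.rpow_pos_of_pos (hpos x hx) _).ne'
      exact ⟨hpos x hx, by linarith [hx.2]⟩
  refine ⟨A, max √K C, le_max_of_le_left (Real.sqrt_nonneg _), fun x hx hxδ => ?_⟩
  have hp : 0 < x ^ (β - 1 + β) := Real.rpow_pos_of_pos hx _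
  rcases lt_or_ge x x₁ with hlt | hge
  · have h1 := hnear x hx hlt
    have e1 : x ^ (β - 1) = x ^ β / x := by rw [Real.rpow_sub_one hx.ne']
    have e2 : x ^ (β - 1 + β) = (x ^ β) ^ 2 / x := by
      rw [Real.rpow_add hx, e1]; ring
    calc |v x - A * x ^ (β - 1)| = |v x * x - A * x ^ β| / x := by
          rw [e1, ← abs_of_pos hx, ← abs_div, abs_of_pos hx]
          congr 1; field_simp
      _ ≤ √K * (x ^ β) ^ 2 / x := by gcongr
      _ = √K * x ^ (β - 1 + β) := by rw [e2, mul_div_assoc]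
      _ ≤ _ := by gcongr; exact le_max_left _ _
  · have h1 := hC x ⟨hge, hxδ.le⟩
    rw [Real.norm_eq_abs, abs_div, abs_of_pos hp, div_le_iff₀ hp] at h1
    exact h1.trans (by gcongr; exact le_max_right _ _)

/-- The open sector of opening angle `φ` and radius `δ` with vertex at the origin. -/
def openSector (φ δ : ℝ) : Set ℂ :=
  {z : ℂ | ∃ r θ : ℝ, 0 < r ∧ r < δ ∧ 0 < θ ∧ θ < φ ∧
    z = (r : ℂ) * Complex.exp ((θ : ℂ) * Complex.I)}

lemma openSector_eq_image_exp {φ δ : ℝ} (hδ : 0 < δ) :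
    openSector φ δ = Complex.exp '' {s | s.re < Real.log δ ∧ 0 < s.im ∧ s.im < φ} := by
  ext z
  constructor
  · rintro ⟨r, θ, hr, hrδ, hθ, hθφ, rfl⟩
    refine ⟨Real.log r + θ * I, ?_, ?_⟩
    · simpa using ⟨Real.log_lt_log hr hrδ, hθ, hθφ⟩
    · rw [Complex.exp_add, ← Complex.ofReal_exp, Real.exp_log hr]
  · rintro ⟨s, ⟨hs, hs0, hsφ⟩, rfl⟩
    refine ⟨Real.exp s.re, s.im, Real.exp_pos _, (Real.lt_log_iff_exp_lt hδ).1 hs, hs0, hsφ, ?_⟩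
    rw [Complex.ofReal_exp, ← Complex.exp_add, re_add_im]

lemma isOpen_openSector {φ δ : ℝ} (hδ : 0 < δ) : IsOpen (openSector φ δ) := by
  rw [openSector_eq_image_exp hδ]
  exact isOpenMap_exp _ ((isOpen_lt continuous_re continuous_const).inter
    ((isOpen_lt continuous_const continuous_im).inter (isOpen_lt continuous_im continuous_const)))

open Set in
lemma mem_closure_openSector {φ δ r θ : ℝ} (hφ : 0 < φ) (hr : 0 < r) (hrδ : r < δ)
    (hθ : θ ∈ Icc 0 φ) : (r : ℂ) * Complex.exp (θ * I) ∈ closure (openSector φ δ) := by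
  rw [← closure_Ioo hφ.ne] at hθ
  exact map_mem_closure (f := fun θ : ℝ => (r : ℂ) * Complex.exp (θ * I)) (by fun_prop) hθ
    fun t ht => ⟨r, t, hr, hrδ, ht.1, ht.2, rfl⟩

/-- The power map `w ↦ w ^ α` opening the upper half plane to a sector of angle `α π`. -/
noncomputable def sectorMap (α : ℝ) (w : ℂ) : ℂ :=
  Complex.exp (α * Complex.log w)

lemma sectorMap_eq {α : ℝ} {w : ℂ} (hw : w ≠ 0) :
    sectorMap α w = ((‖w‖ ^ α : ℝ) : ℂ) * Complex.exp ((α * w.arg : ℝ) * I) := by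
  rw [sectorMap, Real.rpow_def_of_pos (norm_pos_iff.2 hw), Complex.ofReal_exp, ← Complex.exp_add]
  congr 1
  rw [Complex.log]
  push_cast
  ring

lemma sectorMap_ne_zero (α : ℝ) (w : ℂ) : sectorMap α w ≠ 0 := Complex.exp_ne_zero _

lemma norm_sectorMap {α : ℝ} {w : ℂ} (hw : w ≠ 0) : ‖sectorMap α w‖ = ‖w‖ ^ α := by
  rw [sectorMap_eq hw, norm_mul, Complex.norm_exp_ofReal_mul_I, mul_one, Complex.norm_real,
    Real.norm_of_nonneg (by positivity)]

lemma sectorMap_ofReal {α x : ℝ} (hx : 0 < x) : sectorMap α x = ((x ^ α : ℝ) : ℂ) := by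
  rw [sectorMap_eq (by exact_mod_cast hx.ne'), arg_ofReal_of_nonneg hx.le, norm_real,
    Real.norm_of_nonneg hx.le]
  simp

lemma sectorMap_ofReal_of_neg {α x : ℝ} (hx : x < 0) :
    sectorMap α x = ((|x| ^ α : ℝ) : ℂ) * Complex.exp ((α * π : ℝ) * I) := by
  rw [sectorMap_eq (by exact_mod_cast hx.ne), arg_ofReal_of_neg hx, norm_real, Real.norm_eq_abs]

lemma hasDerivAt_sectorMap (α : ℝ) {w : ℂ} (hw : 0 < w.im) :
    HasDerivAt (sectorMap α) (sectorMap α w * (α / w)) w := by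
  have := ((Complex.hasDerivAt_log (Or.inr hw.ne')).const_mul (α : ℂ)).cexp
  rwa [← div_eq_mul_inv] at this

open Set in
lemma continuousOn_sectorMap (α : ℝ) :
    ContinuousOn (sectorMap α) {w : ℂ | 0 ≤ w.im ∧ w ≠ 0} := by
  refine Complex.continuous_exp.comp_continuousOn (continuousOn_const.mul fun w hw => ?_)
  by_cases h : w ∈ slitPlane
  · exact (continuousAt_clog h).continuousWithinAt
  · rw [mem_slitPlane_iff, not_or, not_lt, not_not] at h
    refine (continuousWithinAt_log_of_re_neg_of_im_zero (h.1.lt_of_ne fun h0 => ?_) h.2).mono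
      fun z hz => hz.1
    exact hw.2 (Complex.ext h0 h.2)

lemma arg_mem_Ioo_of_im_pos {w : ℂ} (hw : 0 < w.im) : w.arg ∈ Set.Ioo 0 π := by
  refine ⟨(arg_nonneg_iff.2 hw.le).lt_of_ne fun h => hw.ne ?_, arg_lt_pi_iff.2 (Or.inr hw.ne')⟩
  exact (arg_eq_zero_iff.1 h.symm).2.symm

lemma injOn_sectorMap {α : ℝ} (hα : 0 < α) (hα2 : α < 2) :
    Set.InjOn (sectorMap α) {w : ℂ | 0 < w.im} := by
  intro w hw z hz h
  have hw0 : w ≠ 0 := fun h => by simp [h] at hw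
  have hz0 : z ≠ 0 := fun h => by simp [h] at hz
  obtain ⟨n, hn⟩ := Complex.exp_eq_exp_iff_exists_int.1 h
  have him := congrArg Complex.im hn
  simp only [mul_im, ofReal_re, ofReal_im, zero_mul, add_zero, log_im, add_im, intCast_re,
    intCast_im, re_ofNat, im_ofNat, mul_re, I_re, I_im, mul_zero, mul_one, sub_zero] at him
  obtain ⟨hw1, hw2⟩ := arg_mem_Ioo_of_im_pos hw
  obtain ⟨hz1, hz2⟩ := arg_mem_Ioo_of_im_pos hz
  have hn0 : n = 0 := by
    have hpi := Real.pi_pos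
    have h1 : (n : ℝ) < 1 := by
      by_contra! hle
      nlinarith
    have h2 : (-1 : ℝ) < n := by
      by_contra! hle
      nlinarith
    have h1' : n < 1 := by exact_mod_cast h1
    have h2' : -1 < n := by exact_mod_cast h2
    omega
  rw [hn0, Int.cast_zero, zero_mul, add_zero] at hn
  have hlog := mul_left_cancel₀ (by exact_mod_cast hα.ne') hn
  rw [← Complex.exp_log hw0, hlog, Complex.exp_log hz0]

lemma sectorMap_mem_openSector {α δ : ℝ} (hα : 0 < α) {w : ℂ} (hw : 0 < w.im)
    (hwδ : ‖w‖ ^ α < δ) : sectorMap α w ∈ openSector (α * π) δ := by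
  have hw0 : w ≠ 0 := fun h => by simp [h] at hw
  obtain ⟨h1, h2⟩ := arg_mem_Ioo_of_im_pos hw
  exact ⟨‖w‖ ^ α, α * w.arg, Real.rpow_pos_of_pos (norm_pos_iff.2 hw0) _, hwδ, by positivity,
    by gcongr, sectorMap_eq hw0⟩

lemma sectorMap_mem_closure_openSector {α δ : ℝ} (hα : 0 < α) {w : ℂ} (hw : 0 ≤ w.im)
    (hw0 : w ≠ 0) (hwδ : ‖w‖ ^ α < δ) :
    sectorMap α w ∈ (closure (openSector (α * π) δ) ∩ ball 0 δ) \ {0} := by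
  refine ⟨⟨?_, ?_⟩, sectorMap_ne_zero α w⟩
  · rw [sectorMap_eq hw0]
    exact mem_closure_openSector (by positivity) (Real.rpow_pos_of_pos (norm_pos_iff.2 hw0) _) hwδ
      ⟨mul_nonneg hα.le (arg_nonneg_iff.2 hw), by gcongr; exact arg_le_pi w⟩
  · rwa [mem_ball_zero_iff, norm_sectorMap hw0]

lemma det_restrictScalars_toSpanSingleton (a : ℂ) :
    ((ContinuousLinearMap.toSpanSingleton ℂ a).restrictScalars ℝ).det = ‖a‖ ^ 2 := by
  simp [ContinuousLinearMap.det, LinearMap.det_restrictScalars, Algebra.norm_complex_eq,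
    Complex.normSq_eq_norm_sq]

open Set in
/-- Conformal invariance of the Dirichlet energy under the map opening a half disc to a sector. -/
lemma integrableOn_sectorMap_energy {α δ R : ℝ} (hα : 0 < α) (hα2 : α < 2)
    (hRδ : R ^ α = δ) {f : ℂ → ℂ} (hf : ContinuousOn f (openSector (α * π) δ))
    (hint : IntegrableOn (fun z => ‖f z‖ ^ 2) (openSector (α * π) δ)) :
    IntegrableOn (fun w => (f (sectorMap α w) * sectorMap α w) ^ 2 / w ^ 2)
      {w : ℂ | 0 < w.im ∧ ‖w‖ < R} := by
  set D : Set ℂ := {w : ℂ | 0 < w.im ∧ ‖w‖ < R} with hD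
  have hDopen : IsOpen D := (isOpen_lt continuous_const continuous_im).inter
    (isOpen_lt continuous_norm continuous_const)
  have hD0 : ∀ w ∈ D, w ≠ 0 := fun w hw h => by simp [hD, h] at hw
  have hmaps : MapsTo (sectorMap α) D (openSector (α * π) δ) := fun w hw =>
    sectorMap_mem_openSector hα hw.1 (hRδ ▸ Real.rpow_lt_rpow (norm_nonneg w) hw.2 hα)
  have hψ : ContinuousOn (sectorMap α) D := (continuousOn_sectorMap α).mono fun w hw =>
    ⟨hw.1.le, hD0 w hw⟩
  have hderiv : ∀ w ∈ D, HasFDerivWithinAt (sectorMap α)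
      ((ContinuousLinearMap.toSpanSingleton ℂ (sectorMap α w * (α / w))).restrictScalars ℝ) D w :=
    fun w hw => ((hasDerivAt_sectorMap α hw.1).hasFDerivAt.restrictScalars ℝ).hasFDerivWithinAt
  have hpull := (integrableOn_image_iff_integrableOn_abs_det_fderiv_smul volume
    hDopen.measurableSet hderiv ((injOn_sectorMap hα hα2).mono fun w hw => hw.1) _).1
    (hint.mono_set hmaps.image_subset)
  have hcont : ContinuousOn (fun w => (f (sectorMap α w) * sectorMap α w) ^ 2 / w ^ 2) D :=
    (((hf.comp hψ hmaps).mul hψ).pow 2).div (by fun_prop) fun w hw => pow_ne_zero 2 (hD0 w hw)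
  refine (integrable_norm_iff (hcont.aestronglyMeasurable hDopen.measurableSet)).1 ?_
  refine (hpull.const_mul (α ^ 2)⁻¹).congr ?_
  filter_upwards with w
  rw [det_restrictScalars_toSpanSingleton]
  simp only [norm_div, norm_mul, norm_pow, Complex.norm_real, Real.norm_of_nonneg hα.le,
    smul_eq_mul, abs_pow, abs_mul, abs_div, abs_norm, abs_of_pos hα]
  field_simp

open Set ComplexConjugate in
lemma integrableOn_schwarzReflect_div_sq {Q : ℂ → ℂ} {R : ℝ}
    (hint : IntegrableOn (fun w => Q w / w ^ 2) {w : ℂ | 0 < w.im ∧ ‖w‖ < R}) :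
    IntegrableOn (fun w => schwarzReflect Q w / w ^ 2) (ball 0 R) := by
  set D : Set ℂ := {w : ℂ | 0 < w.im ∧ ‖w‖ < R} with hD
  have hDm : MeasurableSet D := ((isOpen_lt continuous_const continuous_im).inter
    (isOpen_lt continuous_norm continuous_const)).measurableSet
  have hupper : IntegrableOn (fun w => schwarzReflect Q w / w ^ 2) D :=
    hint.congr_fun (fun w hw => by simp [schwarzReflect, hw.1.le]) hDm
  have hlower : IntegrableOn (fun w => schwarzReflect Q w / w ^ 2) (conj ⁻¹' D) := by
    have h1 : IntegrableOn (fun w => conj (Q w / w ^ 2)) D := by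
      have := conjCLE.toContinuousLinearMap.integrable_comp hint
      exact this
    have h2 := (conjLIE.measurePreserving.integrableOn_comp_preimage
      conjLIE.toHomeomorph.measurableEmbedding).2 h1
    refine h2.congr_fun (fun w hw => ?_) (continuous_conj.measurable hDm)
    have him : ¬ 0 ≤ w.im := by simpa [hD] using hw.1
    simp [schwarzReflect, him]
  have haxis : volume {w : ℂ | w.im = 0} = 0 := by
    have := Measure.addHaar_submodule (volume : Measure ℂ) (LinearMap.ker imLm) (fun h => by
      have : (I : ℂ) ∈ LinearMap.ker imLm := h ▸ Submodule.mem_top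
      simp at this)
    exact this
  have haxis' : IntegrableOn (fun w => schwarzReflect Q w / w ^ 2) {w : ℂ | w.im = 0} := by
    rw [IntegrableOn, Measure.restrict_eq_zero.2 haxis]
    exact integrable_zero_measure
  refine ((hupper.union hlower).union haxis').mono_set fun w hw => ?_
  rw [mem_ball_zero_iff] at hw
  rcases lt_trichotomy w.im 0 with h | h | h
  · exact Or.inl (Or.inr (by simpa [hD] using ⟨h, hw⟩))
  · exact Or.inr h
  · exact Or.inl (Or.inl ⟨h, hw⟩)

open Filter Topology in
/-- The complex gradient of a harmonic function on an open set is holomorphic. -/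
lemma differentiableAt_complex_gradient {u : ℂ → ℝ} {S : Set ℂ} (hS : IsOpen S)
    (hu : ContDiffOn ℝ 2 u S)
    (hharm : ∀ z ∈ S, fderiv ℝ (fun w => fderiv ℝ u w 1) z 1
      + fderiv ℝ (fun w => fderiv ℝ u w Complex.I) z Complex.I = 0) {z : ℂ} (hz : z ∈ S) :
    DifferentiableAt ℂ (fun z => (fderiv ℝ u z 1 - I * fderiv ℝ u z I : ℂ)) z := by
  have hcd : ∀ w ∈ S, ContDiffAt ℝ 2 u w := fun w hw => hu.contDiffAt (hS.mem_nhds hw)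
  refine HarmonicAt.differentiableAt_complex_partial ⟨hcd z hz, ?_⟩
  filter_upwards [hS.mem_nhds hz] with w hw
  have hd : DifferentiableAt ℝ (fderiv ℝ u) w :=
    ((hcd w hw).fderiv_right (m := 1) (by norm_num)).differentiableAt one_ne_zero
  have := hharm w hw
  rw [fderiv_clm_apply hd (by fun_prop), fderiv_clm_apply hd (by fun_prop)] at this
  simpa [InnerProductSpace.laplacian_eq_iteratedFDeriv_complexPlane, iteratedFDeriv_two_apply]
    using this

open Set Filter Topology in
/-- Boundary expansion at a corner for a holomorphic function of finite energy in a sector, with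
`w ↦ f(w) w` imaginary on one edge and real on the other. -/
lemma exists_expansion_of_holomorphic_openSector {α δ : ℝ} (hα : 0 < α) (hα2 : α < 2) (hδ : 0 < δ)
    {f : ℂ → ℂ} (hd : ∀ z ∈ openSector (α * π) δ, DifferentiableAt ℂ f z)
    {F : ℂ → ℂ} (hF : ContinuousOn F ((closure (openSector (α * π) δ) ∩ ball 0 δ) \ {0}))
    (hFf : ∀ z ∈ openSector (α * π) δ, F z = f z)
    (hint : IntegrableOn (fun z => ‖f z‖ ^ 2) (openSector (α * π) δ))
    (hDir : ∀ x : ℝ, 0 < x → x < δ → (F x).re = 0)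
    (hNeu : ∀ r : ℝ, 0 < r → r < δ →
      (F (r * Complex.exp ((α * π : ℝ) * I)) * Complex.exp ((α * π : ℝ) * I)).im = 0) :
    ∃ L K ρ : ℝ, 0 ≤ L ∧ 0 < K ∧ 0 < ρ ∧ ∀ x : ℝ, 0 < x → x < ρ →
      |(F x).im ^ 2 * x ^ 2 - x ^ α⁻¹ * L| ≤ K * (x ^ α⁻¹) ^ 2 := by
  set R := δ ^ α⁻¹ with hRdef
  have hR : 0 < R := Real.rpow_pos_of_pos hδ _
  have hRδ : R ^ α = δ := Real.rpow_inv_rpow hδ.le hα.ne'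
  have hlt : ∀ {t : ℝ}, 0 ≤ t → t < R → t ^ α < δ := fun ht htR =>
    hRδ ▸ Real.rpow_lt_rpow ht htR hα
  have hopen := isOpen_openSector (φ := α * π) hδ
  set Q : ℂ → ℂ := fun w => (F (sectorMap α w) * sectorMap α w) ^ 2 with hQ
  have hmem : ∀ w : ℂ, 0 < w.im → ‖w‖ < R → sectorMap α w ∈ openSector (α * π) δ :=
    fun w hw hwR => sectorMap_mem_openSector hα hw (hlt (norm_nonneg w) hwR)
  have hQc : ContinuousOn Q {w | 0 ≤ w.im ∧ w ≠ 0 ∧ ‖w‖ < R} := by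
    have hψ : ContinuousOn (sectorMap α) {w | 0 ≤ w.im ∧ w ≠ 0 ∧ ‖w‖ < R} :=
      (continuousOn_sectorMap α).mono fun w hw => ⟨hw.1, hw.2.1⟩
    exact ((hF.comp hψ fun w hw => sectorMap_mem_closure_openSector hα hw.1 hw.2.1
      (hlt (norm_nonneg w) hw.2.2)).mul hψ).pow 2
  have hQd : ∀ w : ℂ, 0 < w.im → ‖w‖ < R → DifferentiableAt ℂ Q w := by
    intro w hw hwR
    have hFd : DifferentiableAt ℂ F (sectorMap α w) :=
      (hd _ (hmem w hw hwR)).congr_of_eventuallyEq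
        (eventually_of_mem (hopen.mem_nhds (hmem w hw hwR)) hFf)
    have hψ := (hasDerivAt_sectorMap α hw).differentiableAt
    exact ((hFd.comp w hψ).mul hψ).pow 2
  have hQreal : ∀ x : ℝ, x ≠ 0 → |x| < R → (Q x).im = 0 := by
    intro x hx hxR
    have hpos : 0 < |x| ^ α := Real.rpow_pos_of_pos (abs_pos.2 hx) _
    have hxδ := hlt (abs_nonneg x) hxR
    rcases lt_or_gt_of_ne hx with h | h
    · have := hNeu _ hpos hxδ
      simp only [hQ, sectorMap_ofReal_of_neg h]
      rw [mul_left_comm, mul_pow, ← ofReal_pow, im_ofReal_mul, sq (F _ * _), mul_im, this]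
      simp
    · have := hDir _ hpos hxδ
      rw [abs_of_pos h] at this
      simp only [hQ, sectorMap_ofReal h]
      rw [mul_pow, ← ofReal_pow, im_mul_ofReal, sq (F _), mul_im, this]
      simp
  have hQint : IntegrableOn (fun w => Q w / w ^ 2) {w : ℂ | 0 < w.im ∧ ‖w‖ < R} := by
    refine integrableOn_sectorMap_energy hα hα2 hRδ
      (hF.mono fun z hz => ?_) (hint.congr_fun (fun z hz => by simp [hFf z hz]) hopen.measurableSet)
    obtain ⟨r, θ, hr, hrδ, -, -, rfl⟩ := id hz
    refine ⟨⟨subset_closure hz, ?_⟩, ?_⟩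
    · simpa [Complex.norm_exp_ofReal_mul_I, abs_of_pos hr] using hrδ
    · simp [hr.ne', Complex.exp_ne_zero]
  have hPd := differentiableOn_schwarzReflect hQc hQd hQreal
  obtain ⟨c, K, hK, ρ, hρ, hexp⟩ := exists_norm_sub_mul_le_of_tendsto_zero hR hPd
    (tendsto_zero_of_integrableOn_div_sq hR hPd (integrableOn_schwarzReflect_div_sq hQint))
  refine ⟨‖c‖, K, min (ρ ^ α) δ, norm_nonneg c, hK, by positivity, fun x hx hxρ => ?_⟩
  have hw : 0 < x ^ α⁻¹ := Real.rpow_pos_of_pos hx _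
  have hwρ : x ^ α⁻¹ < ρ :=
    (Real.rpow_inv_lt_iff_of_pos hx.le hρ.le hα).2 (hxρ.trans_le (min_le_left _ _))
  have h := hexp (x ^ α⁻¹ : ℝ) (by exact_mod_cast hw.ne')
    (by rwa [norm_real, Real.norm_of_nonneg hw.le])
  have hP : ‖schwarzReflect Q (x ^ α⁻¹ : ℝ)‖ = (F x).im ^ 2 * x ^ 2 := by
    have hre := hDir x hx (hxρ.trans_le (min_le_right _ _))
    rw [schwarzReflect, if_pos (by simp), hQ]
    simp only [sectorMap_ofReal hw, Real.rpow_inv_rpow hx.le hα.ne']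
    rw [norm_pow, norm_mul, mul_pow, ← Complex.normSq_eq_norm_sq (F x), normSq_apply, hre,
      norm_real, Real.norm_eq_abs, sq_abs]
    ring
  have hnorm := (abs_norm_sub_norm_le _ _).trans h
  rwa [hP, norm_mul, norm_real, Real.norm_of_nonneg hw.le] at hnorm

/-- Edge asymptotics at a corner of opening angle `φ`: the normal current
density on the electrode blows up like `dist^{π/(2φ) - 1}`. -/
theorem corner_edge_asymptotics
    (φ δ : ℝ) (hφ : 0 < φ) (hφ' : φ < 2 * π) (hδ : 0 < δ)
    (S : Set ℂ)
    (hSdef : S = {z : ℂ | ∃ r θ : ℝ, 0 < r ∧ r < δ ∧ 0 < θ ∧ θ < φ ∧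
      z = (r : ℂ) * Complex.exp ((θ : ℂ) * Complex.I)})
    (u : ℂ → ℝ) (v₁ v₂ : ℂ → ℝ)
    (hu : ContDiffOn ℝ 2 u S)
    (hharm : ∀ z ∈ S,
      fderiv ℝ (fun w => fderiv ℝ u w 1) z 1
        + fderiv ℝ (fun w => fderiv ℝ u w Complex.I) z Complex.I = 0)
    (hEnergy : IntegrableOn
      (fun z => (fderiv ℝ u z 1) ^ 2 + (fderiv ℝ u z Complex.I) ^ 2) S volume)
    (hv₁cont : ContinuousOn v₁ ((closure S ∩ ball (0 : ℂ) δ) \ {0}))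
    (hv₂cont : ContinuousOn v₂ ((closure S ∩ ball (0 : ℂ) δ) \ {0}))
    (hv₁ : ∀ z ∈ S, v₁ z = fderiv ℝ u z 1)
    (hv₂ : ∀ z ∈ S, v₂ z = fderiv ℝ u z Complex.I)
    (hDir : ∀ x : ℝ, 0 < x → x < δ → v₁ (x : ℂ) = 0)
    (hNeu : ∀ r : ℝ, 0 < r → r < δ →
      -Real.sin φ * v₁ ((r : ℂ) * Complex.exp ((φ : ℂ) * Complex.I))
        + Real.cos φ * v₂ ((r : ℂ) * Complex.exp ((φ : ℂ) * Complex.I)) = 0) :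
    ∃ A C : ℝ, 0 ≤ C ∧ ∀ x : ℝ, 0 < x → x < δ/2 →
      |v₂ (x : ℂ) - A * x ^ (π/(2*φ) - 1)|
        ≤ C * x ^ (π/(2*φ) - 1 + π/(2*φ)) := by
  set α := φ / π with hαdef
  have hα : 0 < α := by positivity
  have hα2 : α < 2 := (div_lt_iff₀ Real.pi_pos).2 hφ'
  have hαφ : α * π = φ := div_mul_cancel₀ φ Real.pi_ne_zero
  have hS : S = openSector (α * π) δ := by rw [hSdef, hαφ, openSector]
  clear hSdef
  subst hS
  have hopen := isOpen_openSector (φ := α * π) hδ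
  set F : ℂ → ℂ := fun z => v₁ z - I * v₂ z with hF
  have hFre : ∀ z, (F z).re = v₁ z := fun z => by simp [hF]
  have hFim : ∀ z, (F z).im = -v₂ z := fun z => by simp [hF]
  obtain ⟨L, K, ρ, hL, hK, hρ, hexp⟩ := exists_expansion_of_holomorphic_openSector hα hα2 hδ
    (f := fun z => (fderiv ℝ u z 1 - I * fderiv ℝ u z I : ℂ))
    (fun z hz => differentiableAt_complex_gradient hopen hu hharm hz) (F := F)
    ((continuous_ofReal.comp_continuousOn hv₁cont).sub
      (continuousOn_const.mul (continuous_ofReal.comp_continuousOn hv₂cont)))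
    (fun z hz => by simp only [hF, hv₁ z hz, hv₂ z hz])
    (hEnergy.congr_fun (fun z _ => by
      simp only [← Complex.normSq_eq_norm_sq, normSq_apply]
      simp [sq]) hopen.measurableSet)
    (fun x hx hxδ => by rw [hFre, hDir x hx hxδ])
    (fun r hr hrδ => by
      rw [hαφ, mul_im, hFre, hFim, Complex.exp_ofReal_mul_I_re, Complex.exp_ofReal_mul_I_im]
      linear_combination -hNeu r hr hrδ)
  have hβ : α⁻¹ = 2 * (π / (2 * φ)) := by rw [hαdef]; field_simp
  refine exists_expansion_of_sq_expansion (v := fun x : ℝ => v₂ x) hδ (by positivity) hL hK hρ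
    (hv₂cont.comp continuous_ofReal.continuousOn fun x hx => ?_) fun x hx hxρ => ?_
  · have hmem := sectorMap_mem_closure_openSector (δ := δ) hα (w := (x ^ α⁻¹ : ℝ)) (by simp)
      (by exact_mod_cast (Real.rpow_pos_of_pos hx.1 _).ne') (by
        rw [norm_real, Real.norm_of_nonneg (Real.rpow_nonneg hx.1.le _),
          Real.rpow_inv_rpow hx.1.le hα.ne']
        exact hx.2)
    rwa [sectorMap_ofReal (Real.rpow_pos_of_pos hx.1 _), Real.rpow_inv_rpow hx.1.le hα.ne'] at hmem
  · have := hexp x hx hxρ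
    rwa [hFim, neg_sq, hβ] at this
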